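/- arXiv:1604.05550 — 3 statements merged into one kernel-verified Lean document; each statement's English description precedes it below -/
import Mathlib

section
/- Let S be a nonempty set, let f : S → ℝ and p : S → ℝ be functions, let δ > 0 and P_max ≥ 0 be real numbers, and assume: (i) 0 ≤ p(x) ≤ P_max for every x ∈ S; (ii) for all x, y ∈ S, if f(x) ≠ f(y) then |f(x) − f(y)| ≥ δ. Set κ = δ / (P_max + 1). If x* ∈ S satisfies f(x*) − κ·p(x*) ≥ f(x) − κ·p(x) for all x ∈ S, then f(x*) ≥ f(x) for all x ∈ S; that is, any maximizer of the power-regularized objective f − κ·p also maximizes f itself. -/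
/-- Lemma 1 (first part): any maximizer of the power-regularized objective
`f - κ·p` with `κ = δ / (P_max + 1)` also maximizes `f` itself. -/
theorem regularized_maximizer_maximizes_rate
    {S : Type*} [Nonempty S] (f p : S → ℝ) (δ Pmax : ℝ)
    (hδ : 0 < δ) (hPmax : 0 ≤ Pmax)
    (hp : ∀ x : S, 0 ≤ p x ∧ p x ≤ Pmax)
    (hf : ∀ x y : S, f x ≠ f y → δ ≤ |f x - f y|)
    (κ : ℝ) (hκ : κ = δ / (Pmax + 1))
    (xstar : S) (hmax : ∀ x : S, f x - κ * p x ≤ f xstar - κ * p xstar) :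
    ∀ x : S, f x ≤ f xstar := by
  intro x
  by_contra! hlt
  have hgap : δ ≤ f x - f xstar := by
    simpa [abs_of_pos (sub_pos.mpr hlt)] using hf x xstar hlt.ne'
  have hκ_pos : 0 < κ := hκ ▸ by positivity
  have hκ_mul : κ * (Pmax + 1) = δ := by
    rw [hκ]
    field_simp
  have hx : κ * p x ≤ κ * Pmax := mul_le_mul_of_nonneg_left (hp x).2 hκ_pos.le
  have hxstar : 0 ≤ κ * p xstar := mul_nonneg hκ_pos.le (hp xstar).1
  linarith [hmax x]
end

section
/- Let P be a nonempty finite index set, let c_p ≤ 0 and m_p ∈ ℝ for each p ∈ P, and let η : ℝ → ℝ be concave and differentiable on (0, ∞). For e > 0 and w > 0 define g^lin(e, w) = min over p ∈ P of [ c_p · ( η(1/w) + η'(1/w) · (e − 1/w) ) + m_p ]. Then g^lin(e, 1/e) = min over p ∈ P of [ c_p · η(e) + m_p ], and consequently the supremum over w > 0 of g^lin(e, w) equals min_{p ∈ P} [ c_p · η(e) + m_p ] and is attained at the optimal linearization weight w* = 1/e. -/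
/-- A concave function lies below each of its tangent lines. -/
theorem ConcaveOn.le_tangent_of_differentiableAt {s : Set ℝ} {f : ℝ → ℝ} (hf : ConcaveOn ℝ s f)
    {x y : ℝ} (hx : x ∈ s) (hy : y ∈ s) (hfd : DifferentiableAt ℝ f x) :
    f y ≤ f x + deriv f x * (y - x) := by
  rcases lt_trichotomy x y with h | rfl | h
  · have hs := hf.slope_le_deriv hx hy h hfd
    rw [slope_def_field, div_le_iff₀ (sub_pos.2 h)] at hs
    linarith
  · simp
  · have hs := hf.deriv_le_slope hy hx h hfd
    rw [slope_def_field, le_div_iff₀ (sub_pos.2 h)] at hs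
    linarith

/-- The linearization is tight at optimality: for every `e > 0`, the linearized
concave-envelope rate function `g^lin(e, w)` evaluated at the optimal weight
`w* = 1/e` equals the concave envelope `min_p [c_p η(e) + m_p]`, and the
supremum of `g^lin(e, ·)` over `w > 0` is attained there with that value. -/
theorem linearization_tight_at_optimality
    {P : Type*} [Fintype P] [Nonempty P]
    (c m : P → ℝ) (hc : ∀ p : P, c p ≤ 0)
    (η : ℝ → ℝ) (hconc : ConcaveOn ℝ (Set.Ioi (0 : ℝ)) η)
    (hdiff : ∀ x : ℝ, 0 < x → DifferentiableAt ℝ η x)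
    (glin : ℝ → ℝ → ℝ)
    (hglin : ∀ e w : ℝ, glin e w =
      Finset.univ.inf' Finset.univ_nonempty
        (fun p : P => c p * (η (1 / w) + deriv η (1 / w) * (e - 1 / w)) + m p)) :
    ∀ e : ℝ, 0 < e →
      glin e (1 / e) =
        Finset.univ.inf' Finset.univ_nonempty (fun p : P => c p * η e + m p) ∧
      IsGreatest ((fun w : ℝ => glin e w) '' Set.Ioi (0 : ℝ))
        (Finset.univ.inf' Finset.univ_nonempty (fun p : P => c p * η e + m p)) := by
  intro e he
  have heq : glin e (1 / e) =
      Finset.univ.inf' Finset.univ_nonempty (fun p : P => c p * η e + m p) := by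
    simp [hglin]
  refine ⟨heq, ⟨1 / e, one_div_pos.2 he, heq⟩, ?_⟩
  rintro _ ⟨w, hw, rfl⟩
  have hw' : 0 < 1 / w := one_div_pos.2 hw
  have htan := hconc.le_tangent_of_differentiableAt hw' he (hdiff _ hw')
  simp only [hglin]
  refine Finset.inf'_mono_fun fun p _ => ?_
  exact add_le_add_left (mul_le_mul_of_nonpos_left htan (hc p)) (m p)
end

section
/- Let R ∈ ℂ^{n×n} be Hermitian positive definite, h ∈ ℂ^n, Φ = R + h hᴴ, and e(u) = 1 − 2·Re(uᴴ h) + uᴴ Φ u for u ∈ ℂ^n. Let P be a nonempty finite index set, c_p ≤ 0 and m_p ∈ ℝ for p ∈ P, and let a ∈ ℝ, b ≥ 0. Then the MMSE filter u* = Φ⁻¹ h maximizes over all u ∈ ℂ^n the linearized objective u ↦ min over p ∈ P of [ c_p · ( a + b · e(u) ) + m_p ]. -/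
open Matrix ComplexOrder

/-- If `A *ᵥ v = h` with `A` positive semidefinite, then `v` minimizes
`u ↦ uᴴ A u - 2 Re (uᴴ h)`. -/
theorem Matrix.PosSemidef.quadratic_le_of_mulVec_eq {ι : Type*} [Fintype ι]
    {A : Matrix ι ι ℂ} (hA : A.PosSemidef) {v h : ι → ℂ} (hv : A *ᵥ v = h) (u : ι → ℂ) :
    (star v ⬝ᵥ (A *ᵥ v)).re - 2 * (star v ⬝ᵥ h).re ≤
      (star u ⬝ᵥ (A *ᵥ u)).re - 2 * (star u ⬝ᵥ h).re := by
  have hnonneg : 0 ≤ (star (u - v) ⬝ᵥ (A *ᵥ (u - v))).re :=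
    (Complex.le_def.1 (hA.dotProduct_mulVec_nonneg (u - v))).1
  have hcross : star v ⬝ᵥ (A *ᵥ u) = star (star u ⬝ᵥ h) := by
    rw [dotProduct_mulVec, ← hv, star_dotProduct, star_star, star_mulVec, hA.isHermitian.eq,
      dotProduct_comm]
  have hcross_re : (star v ⬝ᵥ (A *ᵥ u)).re = (star u ⬝ᵥ h).re := by
    rw [hcross]
    exact Complex.conj_re _
  simp only [star_sub, mulVec_sub, sub_dotProduct, dotProduct_sub, Complex.sub_re, hv,
    hcross_re] at hnonneg
  rw [hv]
  linarith

/-- The optimal receive filter in the block coordinate descent is the MMSE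
filter: `u* = Φ⁻¹ h` maximizes `u ↦ min_p [c_p (a + b·e(u)) + m_p]`, where
`e(u) = 1 − 2·Re(uᴴ h) + uᴴ Φ u`, `c_p ≤ 0` and `b ≥ 0`. -/
theorem mmse_filter_maximizes_linearized_objective
    {n : ℕ} (R : Matrix (Fin n) (Fin n) ℂ) (hR : R.PosDef) (h : Fin n → ℂ)
    (Φ : Matrix (Fin n) (Fin n) ℂ) (hΦ : Φ = R + vecMulVec h (star h))
    (e : (Fin n → ℂ) → ℝ)
    (he : ∀ u : Fin n → ℂ, e u = 1 - 2 * (star u ⬝ᵥ h).re + (star u ⬝ᵥ (Φ *ᵥ u)).re)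
    {P : Type*} [Fintype P] [Nonempty P]
    (c m : P → ℝ) (hc : ∀ p : P, c p ≤ 0)
    (a b : ℝ) (hb : 0 ≤ b)
    (ustar : Fin n → ℂ) (hustar : ustar = Φ⁻¹ *ᵥ h) :
    ∀ u : Fin n → ℂ,
      Finset.univ.inf' Finset.univ_nonempty (fun p : P => c p * (a + b * e u) + m p) ≤
        Finset.univ.inf' Finset.univ_nonempty
          (fun p : P => c p * (a + b * e ustar) + m p) := by
  intro u
  have hΦpos : Φ.PosDef := hΦ ▸ hR.add_posSemidef (posSemidef_vecMulVec_self_star h)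
  have hsol : Φ *ᵥ ustar = h := by
    rw [hustar, mulVec_mulVec, mul_nonsing_inv _ ((isUnit_iff_isUnit_det Φ).1 hΦpos.isUnit),
      one_mulVec]
  have hmin : e ustar ≤ e u := by
    rw [he, he]
    linarith [hΦpos.posSemidef.quadratic_le_of_mulVec_eq hsol u]
  refine Finset.inf'_mono_fun fun p _ => ?_
  have hscaled : a + b * e ustar ≤ a + b * e u := by gcongr
  linarith [mul_le_mul_of_nonpos_left hscaled (hc p)]
end
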